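/- arXiv:1704.00319 — 2 statements merged into one kernel-verified Lean document; each statement's English description precedes it below -/
import Mathlib

section
/- Fix n ∈ ℕ and 1 < p < ∞. The set G_n = {x ∈ M_n : DF_n|_x has rank n(n−1)/2} is an open subset of M_n whose complement has Lebesgue measure zero (and is thus nowhere dense). Moreover, for every x ∈ G_n there exist an open set A ⊆ M_n containing x, an open set B ⊆ ℝ^{n(n−1)/2} containing F_n(x), and a C¹ map Φ : B → A such that F_n ∘ Φ is the identity on B and Φ(F_n(x)) = x. -/
open MeasureTheory
open scoped ENNReal
noncomputable section

/-- The index set of pairs `(i,j)` with `i < j`, indexing the coordinates of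
`ℝ^{n(n-1)/2}`. -/
abbrev PairIdx (n : ℕ) := {q : Fin n × Fin n // q.1 < q.2}

/-- `‖v‖_p` for `v ∈ ℝ^n`. -/
def pNorm (p : ℝ) {n : ℕ} (v : Fin n → ℝ) : ℝ := (∑ k, |v k| ^ p) ^ (1 / p)

/-- The map `F_n : (ℝ^n)^n → ℝ^{n(n-1)/2}`, `F_n(x₁,…,xₙ) = (‖x_i - x_j‖_p^p)_{i<j}`. -/
def Fmap (p : ℝ) (n : ℕ) (x : Fin n → Fin n → ℝ) : PairIdx n → ℝ :=
  fun q => ∑ k, |x q.val.1 k - x q.val.2 k| ^ p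

/-- `G_n`: the set of points of `(ℝ^n)^n` where the derivative of `F_n` has full rank
`n(n-1)/2`. -/
def Gset (p : ℝ) (n : ℕ) : Set (Fin n → Fin n → ℝ) :=
  {x | LinearMap.rank (fderiv ℝ (Fmap p n) x).toLinearMap = ((n * (n - 1) / 2 : ℕ) : Cardinal)}

/-- Property K for an `n`-tuple of points of `ℓ_p` (given by their coordinates). -/
def PropertyKSeq (p : ℝ) (n : ℕ) (x : Fin n → ℕ → ℝ) : Prop :=
  ∃ m : Fin n → ℕ, StrictMono m ∧ (fun i j => x i (m j)) ∈ Gset p n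

/-- Property K for an `n`-tuple of points of `ℓ_p^N`. -/
def PropertyKFin (p : ℝ) (n N : ℕ) (x : Fin n → Fin N → ℝ) : Prop :=
  ∃ m : Fin n → Fin N, StrictMono m ∧ (fun i j => x i (m j)) ∈ Gset p n

/-- A Borel set `A` in a (separable) Banach space is Haar null if there is a Borel
probability measure `μ` with `μ(x + A) = 0` for all `x`. -/
def HaarNull {X : Type*} [AddGroup X] [MeasurableSpace X] (A : Set X) : Prop :=
  ∃ μ : Measure X, IsProbabilityMeasure μ ∧ ∀ x : X, μ ((fun a => x + a) '' A) = 0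

/-- `X` uniformly contains the spaces `ℓ_p^m`, `m ∈ ℕ`. -/
def UnifContainsLp (p : ℝ≥0∞) [Fact (1 ≤ p)] (X : Type*) [NormedAddCommGroup X]
    [NormedSpace ℝ X] : Prop :=
  ∃ C : ℝ, 1 ≤ C ∧ ∀ m : ℕ, ∃ (Y : Submodule ℝ X)
    (T : PiLp p (fun _ : Fin m => ℝ) ≃L[ℝ] Y),
      ‖(T : PiLp p (fun _ : Fin m => ℝ) →L[ℝ] Y)‖ *
        ‖(T.symm : Y →L[ℝ] PiLp p (fun _ : Fin m => ℝ))‖ ≤ C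

-- test lp coercion and instances

/-- The derivative of `u ↦ |u| ^ p`. -/
def absRpowDeriv (p u : ℝ) : ℝ := p * |u| ^ (p - 2) * u

theorem continuous_absRpowDeriv {p : ℝ} (hp : 1 < p) : Continuous (absRpowDeriv p) := by
  have h : deriv (fun u : ℝ => |u| ^ p) = absRpowDeriv p :=
    funext fun u => (hasDerivAt_abs_rpow u hp).deriv
  have hc : ContDiff ℝ 1 (fun u : ℝ => |u| ^ p) := by
    simpa only [Real.norm_eq_abs] using contDiff_norm_rpow (E := ℝ) hp
  exact h ▸ hc.continuous_deriv le_rfl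

theorem absRpowDeriv_of_nonneg {p u : ℝ} (hp : 1 < p) (hu : 0 ≤ u) :
    absRpowDeriv p u = p * u ^ (p - 1) := by
  rcases hu.eq_or_lt with rfl | hu
  · simp [absRpowDeriv, Real.zero_rpow (sub_ne_zero.2 hp.ne')]
  · rw [absRpowDeriv, abs_of_pos hu, mul_assoc, ← Real.rpow_add_one hu.ne']
    ring_nf

theorem strictMono_absRpowDeriv {p : ℝ} (hp : 1 < p) : StrictMono (absRpowDeriv p) := by
  refine strictMono_of_odd_strictMonoOn_nonneg (fun u => by simp [absRpowDeriv]) ?_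
  intro u hu v hv huv
  rw [absRpowDeriv_of_nonneg hp hu, absRpowDeriv_of_nonneg hp hv]
  exact mul_lt_mul_of_pos_left (Real.rpow_lt_rpow hu huv (by linarith)) (by linarith)

theorem contDiff_Fmap {p : ℝ} (hp : 1 < p) (n : ℕ) : ContDiff ℝ 1 (Fmap p n) := by
  refine contDiff_pi.2 fun q => ContDiff.sum fun k _ => ?_
  have h : ContDiff ℝ 1 (fun x : Fin n → Fin n → ℝ => x q.val.1 k - x q.val.2 k) := by fun_prop
  simpa only [Real.norm_eq_abs] using h.norm_rpow hp

theorem fderiv_Fmap_apply {p : ℝ} (hp : 1 < p) {n : ℕ} (x v : Fin n → Fin n → ℝ)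
    (q : PairIdx n) :
    fderiv ℝ (Fmap p n) x v q =
      ∑ k, absRpowDeriv p (x q.val.1 k - x q.val.2 k) * (v q.val.1 k - v q.val.2 k) := by
  have hline : HasDerivAt (fun t : ℝ => x + t • v) v 0 := by
    simpa using ((hasDerivAt_id (0 : ℝ)).smul_const v).const_add x
  have hF : HasFDerivAt (Fmap p n) (fderiv ℝ (Fmap p n) x) (x + (0 : ℝ) • v) := by
    simpa using ((contDiff_Fmap hp n).differentiable one_ne_zero x).hasFDerivAt
  have h₁ := hasDerivAt_pi.1 (hF.comp_hasDerivAt (0 : ℝ) hline) q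
  refine h₁.unique ?_
  have h₂ : ∀ k ∈ (Finset.univ : Finset (Fin n)),
      HasDerivAt (fun t : ℝ => |(x + t • v) q.val.1 k - (x + t • v) q.val.2 k| ^ p)
      (absRpowDeriv p (x q.val.1 k - x q.val.2 k) * (v q.val.1 k - v q.val.2 k)) 0 := by
    intro k _
    have ha : HasDerivAt (fun t : ℝ => (x + t • v) q.val.1 k - (x + t • v) q.val.2 k)
        (v q.val.1 k - v q.val.2 k) 0 :=
      (hasDerivAt_pi.1 (hasDerivAt_pi.1 hline q.val.1) k).sub
        (hasDerivAt_pi.1 (hasDerivAt_pi.1 hline q.val.2) k)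
    have hb := (hasDerivAt_abs_rpow ((x + (0 : ℝ) • v) q.val.1 k - (x + (0 : ℝ) • v) q.val.2 k)
      hp).comp (0 : ℝ) ha
    simpa [absRpowDeriv, Function.comp_def] using hb
  exact HasDerivAt.fun_sum h₂

theorem card_pairIdx (n : ℕ) : Fintype.card (PairIdx n) = n * (n - 1) / 2 := by
  rw [Fintype.card_subtype, Finset.card_filter, Fintype.sum_prod_type_right]
  simp only [← Finset.card_filter, Finset.filter_gt_eq_Iio, Fin.card_Iio]
  rw [Fin.sum_univ_eq_sum_range (fun i => i), Finset.sum_range_id]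

theorem rank_pairIdx (n : ℕ) :
    Module.rank ℝ (PairIdx n → ℝ) = ((n * (n - 1) / 2 : ℕ) : Cardinal) := by
  rw [rank_fun', card_pairIdx]

theorem mem_Gset_iff_range_eq_top {p : ℝ} {n : ℕ} {x : Fin n → Fin n → ℝ} :
    x ∈ Gset p n ↔ (fderiv ℝ (Fmap p n) x).toLinearMap.range = ⊤ := by
  refine ⟨fun h => ?_, fun h => ?_⟩
  · refine Submodule.eq_top_of_finrank_eq ?_
    have h' : Module.rank ℝ (fderiv ℝ (Fmap p n) x).toLinearMap.range = _ := h
    rw [Module.finrank, h', Module.finrank, rank_pairIdx]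
  · change Module.rank ℝ (fderiv ℝ (Fmap p n) x).toLinearMap.range = _
    rw [h, rank_top, rank_pairIdx]

theorem isOpen_Gset {p : ℝ} (hp : 1 < p) (n : ℕ) : IsOpen (Gset p n) := by
  have h : Gset p n = fderiv ℝ (Fmap p n) ⁻¹'
      {f | ((n * (n - 1) / 2 : ℕ) : Cardinal) ≤ LinearMap.rank f.toLinearMap} := by
    ext x
    refine ⟨fun hx => hx.ge, fun hx => le_antisymm ?_ hx⟩
    exact (LinearMap.rank_le_range _).trans_eq (rank_pairIdx n)
  rw [h]
  exact (isOpen_setOfPred_nat_le_rank _).preimage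
    ((contDiff_Fmap hp n).continuous_fderiv one_ne_zero)

/-- Two square matrices that agree outside the bottom right entry have determinants differing by
the difference of these entries times the complementary minor. -/
theorem Matrix.det_sub_det_of_eq_off_last {R : Type*} [CommRing R] {m : ℕ}
    {A B : Matrix (Fin (m + 1)) (Fin (m + 1)) R}
    (h : ∀ i j, ¬(i = Fin.last m ∧ j = Fin.last m) → A i j = B i j) :
    A.det - B.det = (A (Fin.last m) (Fin.last m) - B (Fin.last m) (Fin.last m)) *
      (A.submatrix Fin.castSucc Fin.castSucc).det := by
  have hsub : ∀ j : Fin (m + 1), A.submatrix (Fin.last m).succAbove j.succAbove =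
      B.submatrix (Fin.last m).succAbove j.succAbove := fun j => by
    ext a b
    exact h _ _ fun hab => Fin.succAbove_ne _ _ hab.1
  rw [Matrix.det_succ_row A (Fin.last m), Matrix.det_succ_row B (Fin.last m),
    ← Finset.sum_sub_distrib, Finset.sum_eq_single (Fin.last m)]
  · rw [← hsub, ← sub_mul, ← mul_sub, Fin.succAbove_last, Even.neg_one_pow (by simp), one_mul]
  · intro j _ hj
    rw [← hsub, h _ j fun hab => hj hab.2, sub_self]
  · simp

/-- The matrix with entries `g (x_a k - x_i k)` for `k, a < m`. -/
def diffMatrix (g : ℝ → ℝ) {n m : ℕ} (h : m ≤ n) (i : Fin n) (x : Fin n → Fin n → ℝ) :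
    Matrix (Fin m) (Fin m) ℝ :=
  Matrix.of fun k a => g (x (Fin.castLE h a) (Fin.castLE h k) - x i (Fin.castLE h k))

theorem continuous_det_diffMatrix {g : ℝ → ℝ} (hg : Continuous g) {n m : ℕ} (h : m ≤ n)
    (i : Fin n) : Continuous fun x => (diffMatrix g h i x).det := by
  refine Continuous.matrix_det (continuous_matrix fun k a => ?_)
  simp only [diffMatrix, Matrix.of_apply]
  fun_prop

theorem ae_det_diffMatrix_ne_zero {g : ℝ → ℝ} (hg : Continuous g) (hinj : Function.Injective g)
    {n : ℕ} (i : Fin n) {m : ℕ} (h : m ≤ i.val) :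
    ∀ᵐ x : Fin n → Fin n → ℝ, (diffMatrix g (h.trans i.isLt.le) i x).det ≠ 0 := by
  induction m with
  | zero => simp
  | succ m ih =>
    have hm : m ≤ n := (Nat.le_of_succ_le h).trans i.isLt.le
    set l : Fin n := Fin.castLE (h.trans i.isLt.le) (Fin.last m) with hl
    have hli : l ≠ i := fun e => by
      have := congrArg Fin.val e
      simp [hl] at this
      omega
    let s : Set (Fin n → Fin n → ℝ) := {x | (diffMatrix g hm i x).det = 0 ∨
      (diffMatrix g (h.trans i.isLt.le) i x).det ≠ 0}
    have hs : MeasurableSet s :=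
      ((isClosed_singleton.preimage (continuous_det_diffMatrix hg hm i)).measurableSet).union
        ((isOpen_ne.preimage (continuous_det_diffMatrix hg _ i)).measurableSet)
    let L : ℝ →L[ℝ] (Fin n → Fin n → ℝ) :=
      ContinuousLinearMap.toSpanSingleton ℝ (Pi.single l (Pi.single l (1 : ℝ)))
    have hLne : ∀ (t : ℝ) (a k : Fin n), ¬(k = l ∧ a = l) → L t a k = 0 := by
      intro t a k hak
      by_cases ha : a = l
      · have hk : k ≠ l := fun hk => hak ⟨hk, ha⟩
        simp [L, ha, hk]
      · simp [L, ha]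
    have hLl : ∀ t : ℝ, L t l l = t := fun t => by simp [L]
    have key : ∀ y, ∀ᵐ t : ℝ, y + L.toLinearMap t ∈ s := by
      intro y
      rw [ae_iff]
      refine Set.Subsingleton.measure_zero ?_ _
      intro t ht u hu
      simp only [s, Set.mem_ofPred_eq, not_or, not_not] at ht hu
      obtain ⟨ht₀, ht₁⟩ := ht
      obtain ⟨-, hu₁⟩ := hu
      have hdet := Matrix.det_sub_det_of_eq_off_last
        (A := diffMatrix g (h.trans i.isLt.le) i (y + L t))
        (B := diffMatrix g (h.trans i.isLt.le) i (y + L u)) (by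
          intro k a hka
          have hne : ¬(Fin.castLE (h.trans i.isLt.le) k = l ∧
              Fin.castLE (h.trans i.isLt.le) a = l) := fun e => hka
            ⟨Fin.castLE_injective _ e.1, Fin.castLE_injective _ e.2⟩
          simp [diffMatrix, hLne _ _ _ hne, hLne _ i _ fun e => hli e.2.symm])
      have hsub : (diffMatrix g (h.trans i.isLt.le) i (y + L t)).submatrix
          Fin.castSucc Fin.castSucc = diffMatrix g hm i (y + L t) := rfl
      rw [hsub] at hdet
      change (diffMatrix g _ i (y + L t)).det = 0 at ht₁
      change (diffMatrix g _ i (y + L u)).det = 0 at hu₁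
      rw [ht₁, hu₁, sub_zero, zero_eq_mul] at hdet
      have := hinj (sub_eq_zero.1 (hdet.resolve_right ht₀))
      rw [← hl] at this
      simpa [hLl, hLne _ i _ fun e => hli e.2.symm] using this
    have hae := ae_mem_of_ae_add_linearMap_mem L.toLinearMap volume volume hs key
    filter_upwards [hae, ih (Nat.le_of_succ_le h)] with x hx hx₀
    exact hx.resolve_left hx₀

theorem mem_Gset_of_det_diffMatrix_ne_zero {p : ℝ} (hp : 1 < p) {n : ℕ} {x : Fin n → Fin n → ℝ}
    (hx : ∀ i : Fin n, (diffMatrix (absRpowDeriv p) i.isLt.le i x).det ≠ 0) : x ∈ Gset p n := by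
  rw [mem_Gset_iff_range_eq_top]
  by_contra hne
  obtain ⟨φ, hφ, hle⟩ := Submodule.exists_le_ker_of_lt_top _ (lt_top_iff_ne_top.2 hne)
  set c : PairIdx n → ℝ := fun q => φ (Pi.single q 1) with hc
  have hφc : ∀ y, φ y = ∑ q, c q * y q := fun y => by
    conv_lhs => rw [← Finset.univ_sum_single y, map_sum]
    refine Finset.sum_congr rfl fun q _ => ?_
    rw [hc, mul_comm, ← smul_eq_mul, ← map_smul, ← Pi.single_smul, smul_eq_mul, mul_one]
  have hzero : ∀ v, ∑ q, c q * fderiv ℝ (Fmap p n) x v q = 0 := fun v => by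
    rw [← hφc]
    exact hle ⟨v, rfl⟩
  have hc₀ : ∀ i : Fin n, ∀ q : PairIdx n, q.val.2 = i → c q = 0 := by
    intro i
    induction i using WellFoundedGT.induction with
    | ind i ih =>
    let e : Fin i.val → PairIdx n := fun a =>
      ⟨(Fin.castLE i.isLt.le a, i), Fin.lt_def.2 (by simp)⟩
    have he : Function.Injective e := fun a b hab => by
      have h := congrArg (fun q : PairIdx n => q.val.1.val) hab
      exact Fin.ext h
    have hmem : ∀ q : PairIdx n, q.val.2 = i → q ∈ Set.range e := by
      rintro ⟨⟨a, b⟩, hab⟩ rfl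
      exact ⟨⟨a.val, hab⟩, rfl⟩
    have hmul : (diffMatrix (absRpowDeriv p) i.isLt.le i x).mulVec (fun a => c (e a)) = 0 := by
      ext k
      have h := hzero (Pi.single i (Pi.single (Fin.castLE i.isLt.le k) (1 : ℝ)))
      rw [← Finset.sum_subset (Finset.subset_univ (Finset.univ.image e)),
        Finset.sum_image fun a _ b _ hab => he hab] at h
      · rw [Pi.zero_apply, ← neg_eq_zero, ← h, Matrix.mulVec, dotProduct, ← Finset.sum_neg_distrib]
        refine Finset.sum_congr rfl fun a _ => ?_
        have hai : (e a).val.1 ≠ i := (e a).property.ne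
        rw [fderiv_Fmap_apply hp]
        simp only [Pi.single_eq_of_ne hai, Pi.zero_apply, zero_sub]
        rw [Finset.sum_eq_single (Fin.castLE i.isLt.le k)]
        · simp [e, diffMatrix, mul_comm]
        · intro k' _ hk'
          simp [e, hk']
        · simp
      · intro q _ hq
        have hq₂ : q.val.2 ≠ i := fun h' => hq (by simpa using hmem q h')
        by_cases hq₁ : q.val.1 = i
        · rw [ih q.val.2 (hq₁ ▸ q.property) q rfl, zero_mul]
        · rw [fderiv_Fmap_apply hp]
          simp [hq₁, hq₂]
    have hv := Matrix.eq_zero_of_mulVec_eq_zero (hx i) hmul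
    intro q hq
    obtain ⟨a, rfl⟩ := hmem q hq
    exact congrFun hv a
  refine hφ (LinearMap.ext fun y => ?_)
  rw [hφc]
  simp [hc₀ _ _ rfl]

theorem volume_compl_Gset {p : ℝ} (hp : 1 < p) (n : ℕ) : volume (Gset p n)ᶜ = 0 := by
  rw [← mem_ae_iff]
  filter_upwards [ae_all_iff.2 fun i : Fin n => ae_det_diffMatrix_ne_zero
    (continuous_absRpowDeriv hp) (strictMono_absRpowDeriv hp).injective i le_rfl] with x hx
  exact mem_Gset_of_det_diffMatrix_ne_zero hp hx

/-- A `C¹` map whose derivative at a point is onto a finite-dimensional space has a local `C¹`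
right inverse there. -/
theorem ContDiff.exists_local_rightInverse {E F : Type*} [NormedAddCommGroup E] [NormedSpace ℝ E]
    [NormedAddCommGroup F] [NormedSpace ℝ F] [FiniteDimensional ℝ F] {f : E → F}
    (hf : ContDiff ℝ 1 f) {x : E} (hx : (fderiv ℝ f x).toLinearMap.range = ⊤) :
    ∃ (B : Set F) (Φ : F → E), IsOpen B ∧ f x ∈ B ∧ ContDiffOn ℝ 1 Φ B ∧
      (∀ y ∈ B, f (Φ y) = y) ∧ Φ (f x) = x := by
  have : CompleteSpace F := FiniteDimensional.complete ℝ F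
  obtain ⟨R, hR⟩ := (fderiv ℝ f x).exists_rightInverse_of_surjective hx
  let σ : F → E := fun y => x + R (y - f x)
  have hσx : σ (f x) = x := by simp [σ]
  have hσ : ContDiff ℝ 1 σ := by fun_prop
  have hσ' : HasFDerivAt σ R (f x) :=
    (R.hasFDerivAt.comp (f x) ((hasFDerivAt_id (f x)).sub_const (f x))).const_add x
  have hfx : HasFDerivAt f (fderiv ℝ f x) (σ (f x)) := by
    rw [hσx]
    exact (hf.differentiable one_ne_zero x).hasFDerivAt
  have hc : ContDiffAt ℝ 1 (f ∘ σ) (f x) := (hf.comp hσ).contDiffAt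
  have hd : HasFDerivAt (f ∘ σ) ((ContinuousLinearEquiv.refl ℝ F : F ≃L[ℝ] F) : F →L[ℝ] F)
      (f x) := by
    have := hfx.comp (f x) hσ'
    rw [hR] at this
    exact this
  have hval : (f ∘ σ) (f x) = f x := by simp [hσx]
  have hinv := hc.to_localInverse hd one_ne_zero
  have hright := (hc.hasStrictFDerivAt' hd one_ne_zero).eventually_right_inverse
  have hleft := hc.localInverse_apply_image hd one_ne_zero
  change ∀ᶠ y in nhds _, (f ∘ σ) (hc.localInverse hd one_ne_zero y) = y at hright
  rw [hval] at hinv hright hleft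
  obtain ⟨B, hB, hBo, hxB⟩ := eventually_nhds_iff.1 ((hinv.eventually (by simp)).and hright)
  refine ⟨B, σ ∘ hc.localInverse hd one_ne_zero, hBo, hxB, ?_, fun y hy => (hB y hy).2, ?_⟩
  · exact fun y hy => (hσ.contDiffAt.comp y (hB y hy).1).contDiffWithinAt
  · rw [Function.comp_apply, hleft, hσx]

/-- `G_n` is open, its complement is Lebesgue null (hence nowhere
dense), and at every point of `G_n` the map `F_n` admits a local `C¹` right inverse. -/
theorem stmt2 (p : ℝ) (hp : 1 < p) (n : ℕ) :
    IsOpen (Gset p n) ∧ volume (Gset p n)ᶜ = 0 ∧ IsNowhereDense (Gset p n)ᶜ ∧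
    ∀ x ∈ Gset p n, ∃ (A : Set (Fin n → Fin n → ℝ)) (B : Set (PairIdx n → ℝ))
      (Φ : (PairIdx n → ℝ) → (Fin n → Fin n → ℝ)),
        IsOpen A ∧ IsOpen B ∧ x ∈ A ∧ Fmap p n x ∈ B ∧
        ContDiffOn ℝ 1 Φ B ∧ Φ '' B ⊆ A ∧
        (∀ y ∈ B, Fmap p n (Φ y) = y) ∧ Φ (Fmap p n x) = x := by
  refine ⟨isOpen_Gset hp n, volume_compl_Gset hp n, ?_, fun x hx => ?_⟩
  · rw [(isOpen_Gset hp n).isClosed_compl.isNowhereDense_iff]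
    exact Measure.interior_eq_empty_of_null (volume_compl_Gset hp n)
  · obtain ⟨B, Φ, hBo, hxB, hΦ, hright, hΦx⟩ :=
      (contDiff_Fmap hp n).exists_local_rightInverse (mem_Gset_iff_range_eq_top.1 hx)
    exact ⟨Set.univ, B, Φ, isOpen_univ, hBo, Set.mem_univ x, hxB, hΦ, Set.subset_univ _, hright,
      hΦx⟩
end
end

section
/- Let 1 < p < ∞, N ≥ n, and let x = (x_1,…,x_n) be an n-tuple in ℓ_p^N with Property K. Define F̃ : (ℝ^N)^n → ℝ^{n(n−1)/2} by F̃(y_1,…,y_n) = (‖y_i − y_j‖_p)_{1 ≤ i < j ≤ n}. Then there exist an open set B̃ ⊆ ℝ^{n(n−1)/2} containing F̃(x) and a continuous map Ψ : B̃ → (ℝ^N)^n such that F̃(x) ∈ B̃, Ψ(F̃(x)) = x, and F̃ ∘ Ψ is the identity on B̃. In particular, there is ε > 0 such that every ε-perturbation of the metric space {x_1,…,x_n} embeds isometrically into ℓ_p^N, with the embedding depending continuously on the perturbation. -/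
open MeasureTheory
open scoped ENNReal
noncomputable section

-- test lp coercion and instances

/-- A map between finite-dimensional spaces whose strict derivative at a point is surjective has a
continuous right inverse near the image of that point. -/
theorem HasStrictFDerivAt.exists_continuousOn_rightInverse {E F : Type*}
    [NormedAddCommGroup E] [NormedSpace ℝ E]
    [NormedAddCommGroup F] [NormedSpace ℝ F] [FiniteDimensional ℝ F]
    {f : E → F} {f' : E →L[ℝ] F} {a : E} (hf : HasStrictFDerivAt f f' a)
    (hsurj : Function.Surjective f') :
    ∃ (U : Set F) (g : F → E), IsOpen U ∧ f a ∈ U ∧ ContinuousOn g U ∧ g (f a) = a ∧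
      ∀ y ∈ U, f (g y) = y := by
  have : CompleteSpace F := FiniteDimensional.complete ℝ F
  obtain ⟨r, hr⟩ := f'.toLinearMap.exists_rightInverse_of_surjective
    (LinearMap.range_eq_top.2 hsurj)
  set R : F →L[ℝ] E := LinearMap.toContinuousLinearMap r with hR
  have hR0 : HasStrictFDerivAt (fun w => a + R w) R 0 := R.hasStrictFDerivAt.const_add a
  have hf0 : HasStrictFDerivAt f f' (a + R 0) := by simpa using hf
  have hcomp := hf0.comp (0 : F) hR0
  have hid : f'.comp R = ((ContinuousLinearEquiv.refl ℝ F : F ≃L[ℝ] F) : F →L[ℝ] F) := by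
    ext w
    exact LinearMap.congr_fun hr w
  rw [hid] at hcomp
  set h := hcomp.toOpenPartialHomeomorph _ with hh
  have hcoe : ∀ w, h w = f (a + R w) := fun w => rfl
  have h0 : (0 : F) ∈ h.source := hcomp.mem_toOpenPartialHomeomorph_source
  have hfa : h 0 = f a := by simp [hcoe]
  refine ⟨h.target, fun y => a + R (h.symm y), h.open_target, ?_, ?_, ?_, ?_⟩
  · rw [← hfa]
    exact h.map_source h0
  · exact continuousOn_const.add (R.continuous.comp_continuousOn h.continuousOn_symm)
  · simp only
    rw [← hfa, h.left_inv h0]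
    simp
  · intro y hy
    exact (hcoe _).symm.trans (h.right_inv hy)

theorem surjective_fderiv_of_mem_Gset {p : ℝ} {n : ℕ} {z : Fin n → Fin n → ℝ}
    (hz : z ∈ Gset p n) : Function.Surjective (fderiv ℝ (Fmap p n) z) := by
  have h : LinearMap.rank (fderiv ℝ (Fmap p n) z).toLinearMap
      = ((n * (n - 1) / 2 : ℕ) : Cardinal) := hz
  refine LinearMap.range_eq_top.1 (Submodule.eq_top_of_finrank_eq ?_)
  rw [Module.finrank_fintype_fun_eq_card, card_pairIdx]
  exact Module.finrank_eq_of_rank_eq h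

theorem Fmap_nonneg (p : ℝ) {n : ℕ} (z : Fin n → Fin n → ℝ) (q : PairIdx n) :
    0 ≤ Fmap p n z q :=
  Finset.sum_nonneg fun _ _ => Real.rpow_nonneg (abs_nonneg _) _

/-- A point where the derivative of `Fmap` has full rank has distinct components: a vanishing
coordinate of `Fmap` would be a minimum, hence have zero derivative. -/
theorem Fmap_pos_of_mem_Gset {p : ℝ} (hp : 1 < p) {n : ℕ} {z : Fin n → Fin n → ℝ}
    (hz : z ∈ Gset p n) (q : PairIdx n) : 0 < Fmap p n z q := by
  refine (Fmap_nonneg p z q).lt_of_ne' fun h0 => ?_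
  have hmin : IsLocalMin (fun w => Fmap p n w q) z :=
    Filter.Eventually.of_forall fun w => h0.le.trans (Fmap_nonneg p w q)
  have hd : HasFDerivAt (Fmap p n) (fderiv ℝ (Fmap p n) z) z :=
    ((contDiff_Fmap hp n).differentiable one_ne_zero z).hasFDerivAt
  have hzero := hmin.hasFDerivAt_eq_zero (hasFDerivAt_pi'.1 hd q)
  obtain ⟨v, hv⟩ := surjective_fderiv_of_mem_Gset hz (fun _ => 1)
  have hv1 := congrFun hv q
  have hv0 := DFunLike.congr_fun hzero v
  simp only [ContinuousLinearMap.comp_apply, ContinuousLinearMap.proj_apply, hv1] at hv0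
  exact one_ne_zero hv0

/-- The coordinates indexed by `m` are replaced by those of `z`, the others are those of `x`. -/
def extendCoords {n N : ℕ} (m : Fin n → Fin N) (x : Fin n → Fin N → ℝ)
    (z : Fin n → Fin n → ℝ) : Fin n → Fin N → ℝ :=
  fun i => Function.extend m (z i) (x i)

theorem continuous_extendCoords {n N : ℕ} {m : Fin n → Fin N} (hm : Function.Injective m)
    (x : Fin n → Fin N → ℝ) : Continuous (extendCoords m x) := by
  refine continuous_pi fun i => continuous_pi fun k => ?_
  by_cases hk : ∃ j, m j = k
  · obtain ⟨j, rfl⟩ := hk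
    simp only [extendCoords, hm.extend_apply]
    fun_prop
  · simp only [extendCoords, Function.extend_apply' _ _ _ hk]
    fun_prop

theorem extendCoords_self {n N : ℕ} {m : Fin n → Fin N} (hm : Function.Injective m)
    (x : Fin n → Fin N → ℝ) : extendCoords m x (fun i j => x i (m j)) = x := by
  funext i k
  by_cases hk : ∃ j, m j = k
  · obtain ⟨j, rfl⟩ := hk
    simp only [extendCoords, hm.extend_apply]
  · simp only [extendCoords, Function.extend_apply' _ _ _ hk]

theorem sum_extendCoords {p : ℝ} {n N : ℕ} {m : Fin n → Fin N} (hm : Function.Injective m)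
    (x : Fin n → Fin N → ℝ) (z : Fin n → Fin n → ℝ) (q : PairIdx n) :
    ∑ k, |extendCoords m x z q.val.1 k - extendCoords m x z q.val.2 k| ^ p =
      Fmap p n z q + ∑ k ∈ (Finset.univ.image m)ᶜ, |x q.val.1 k - x q.val.2 k| ^ p := by
  rw [← Finset.sum_add_sum_compl (Finset.univ.image m), Finset.sum_image hm.injOn]
  congr 1
  · simp only [extendCoords, hm.extend_apply, Fmap]
  · refine Finset.sum_congr rfl fun k hk => ?_
    have hk' : ¬ ∃ j, m j = k := by simpa using hk
    simp only [extendCoords, Function.extend_apply' _ _ _ hk']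

theorem pNorm_sub_comm (p : ℝ) {n : ℕ} (v w : Fin n → ℝ) : pNorm p (v - w) = pNorm p (w - v) := by
  simp only [pNorm, Pi.sub_apply, abs_sub_comm]

theorem pNorm_sub_self {p : ℝ} (hp : 0 < p) {n : ℕ} (v : Fin n → ℝ) : pNorm p (v - v) = 0 := by
  simp [pNorm, Real.zero_rpow hp.ne', hp.ne']

theorem pNorm_rpow {p : ℝ} (hp : 0 < p) {n : ℕ} (v : Fin n → ℝ) :
    pNorm p v ^ p = ∑ k, |v k| ^ p := by
  rw [pNorm, one_div, Real.rpow_inv_rpow _ hp.ne']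
  exact Finset.sum_nonneg fun _ _ => Real.rpow_nonneg (abs_nonneg _) _

theorem exists_continuousOn_pNorm_rightInverse {p : ℝ} (hp : 1 < p) {n N : ℕ}
    {x : Fin n → Fin N → ℝ} (hx : PropertyKFin p n N x) :
    ∃ (B : Set (PairIdx n → ℝ)) (Ψ : (PairIdx n → ℝ) → (Fin n → Fin N → ℝ)),
      IsOpen B ∧ (fun q : PairIdx n => pNorm p (x q.val.1 - x q.val.2)) ∈ B ∧
      ContinuousOn Ψ B ∧
      Ψ (fun q : PairIdx n => pNorm p (x q.val.1 - x q.val.2)) = x ∧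
      ∀ Y ∈ B, (fun q : PairIdx n => pNorm p (Ψ Y q.val.1 - Ψ Y q.val.2)) = Y := by
  have hp0 : 0 < p := one_pos.trans hp
  obtain ⟨m, hmono, hz⟩ := hx
  have hm := hmono.injective
  set z : Fin n → Fin n → ℝ := fun i j => x i (m j) with hzdef
  obtain ⟨U, g, hU, hzU, hg, hgz, hFg⟩ :=
    ((contDiff_Fmap hp n).contDiffAt.hasStrictFDerivAt (x := z)
      one_ne_zero).exists_continuousOn_rightInverse (surjective_fderiv_of_mem_Gset hz)
  set c : PairIdx n → ℝ :=
    fun q => ∑ k ∈ (Finset.univ.image m)ᶜ, |x q.val.1 k - x q.val.2 k| ^ p with hc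
  set T : (PairIdx n → ℝ) → PairIdx n → ℝ := fun Y q => Y q ^ p - c q with hT
  have hTcont : Continuous T := by
    refine continuous_pi fun q => ?_
    exact ((continuous_apply q).rpow_const fun _ => Or.inr hp0.le).sub continuous_const
  have hsum : ∀ q : PairIdx n, ∑ k, |x q.val.1 k - x q.val.2 k| ^ p = Fmap p n z q + c q := by
    intro q
    have := sum_extendCoords (p := p) hm x z q
    rwa [extendCoords_self hm] at this
  have hTx : T (fun q => pNorm p (x q.val.1 - x q.val.2)) = Fmap p n z := by
    funext q
    simp only [hT, pNorm_rpow hp0, Pi.sub_apply, hsum, add_sub_cancel_right]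
  refine ⟨{Y | ∀ q, 0 < Y q} ∩ T ⁻¹' U, fun Y => extendCoords m x (g (T Y)), ?_, ⟨?_, ?_⟩,
    ?_, ?_, ?_⟩
  · refine IsOpen.inter ?_ (hU.preimage hTcont)
    simp only [Set.ofPred_forall]
    exact isOpen_iInter_of_finite fun q => isOpen_lt continuous_const (continuous_apply q)
  · intro q
    refine Real.rpow_pos_of_pos ?_ _
    simp only [Pi.sub_apply, hsum]
    exact add_pos_of_pos_of_nonneg (Fmap_pos_of_mem_Gset hp hz q)
      (Finset.sum_nonneg fun _ _ => Real.rpow_nonneg (abs_nonneg _) _)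
  · rw [Set.mem_preimage, hTx]
    exact hzU
  · exact (continuous_extendCoords hm x).comp_continuousOn
      (hg.comp hTcont.continuousOn fun Y hY => hY.2)
  · simp only [hTx, hgz]
    exact extendCoords_self hm x
  · intro Y hY
    funext q
    simp only [pNorm, Pi.sub_apply, sum_extendCoords hm, hFg _ hY.2]
    change (Y q ^ p - c q + c q) ^ (1 / p) = Y q
    rw [sub_add_cancel, one_div, Real.rpow_rpow_inv (hY.1 q).le hp0.ne']

/-- If `x` is an `n`-tuple in `ℓ_p^N` (`N ≥ n`) with Property K, then
the map `F̃(y₁,…,yₙ) = (‖y_i - y_j‖_p)_{i<j}` admits a continuous right inverse `Ψ` on an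
open neighbourhood `B̃` of `F̃(x)` with `Ψ(F̃(x)) = x`. In particular there is `ε > 0`
such that every `ε`-perturbation of `{x₁,…,xₙ}` embeds isometrically into `ℓ_p^N`. -/
theorem stmt6 (p : ℝ) (hp : 1 < p) (n N : ℕ) (hN : n ≤ N) (x : Fin n → Fin N → ℝ)
    (hx : PropertyKFin p n N x) :
    (∃ (B : Set (PairIdx n → ℝ)) (Ψ : (PairIdx n → ℝ) → (Fin n → Fin N → ℝ)),
      IsOpen B ∧ (fun q : PairIdx n => pNorm p (x q.val.1 - x q.val.2)) ∈ B ∧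
      ContinuousOn Ψ B ∧
      Ψ (fun q : PairIdx n => pNorm p (x q.val.1 - x q.val.2)) = x ∧
      ∀ Y ∈ B, (fun q : PairIdx n => pNorm p (Ψ Y q.val.1 - Ψ Y q.val.2)) = Y) ∧
    ∃ ε > (0 : ℝ), ∀ (Y : Type) [MetricSpace Y] (y : Fin n → Y),
      (∀ i j, |dist (y i) (y j) - pNorm p (x i - x j)| < ε) →
      ∃ f : Fin n → Fin N → ℝ, ∀ i j, pNorm p (f i - f j) = dist (y i) (y j) := by
  obtain ⟨B, Ψ, hB, hxB, hΨ, hΨx, hΨB⟩ := exists_continuousOn_pNorm_rightInverse hp hx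
  refine ⟨⟨B, Ψ, hB, hxB, hΨ, hΨx, hΨB⟩, ?_⟩
  obtain ⟨ε, hε, hball⟩ := Metric.isOpen_iff.1 hB _ hxB
  refine ⟨ε, hε, fun Y _ y hy => ?_⟩
  have hmem : (fun q : PairIdx n => dist (y q.val.1) (y q.val.2)) ∈ B :=
    hball ((dist_pi_lt_iff hε).2 fun q => hy _ _)
  have hlt : ∀ i j, i < j → pNorm p (Ψ (fun q => dist (y q.val.1) (y q.val.2)) i -
      Ψ (fun q => dist (y q.val.1) (y q.val.2)) j) = dist (y i) (y j) :=
    fun i j hij => congrFun (hΨB _ hmem) ⟨(i, j), hij⟩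
  refine ⟨Ψ fun q => dist (y q.val.1) (y q.val.2), fun i j => ?_⟩
  rcases lt_trichotomy i j with hij | rfl | hij
  · exact hlt i j hij
  · rw [pNorm_sub_self (one_pos.trans hp), dist_self]
  · rw [pNorm_sub_comm, dist_comm, hlt j i hij]
end
end
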